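/- arXiv:2508.06396 — 3 statements merged into one kernel-verified Lean document; each statement's English description precedes it below -/
import Mathlib

section
/- Let h be a finite-dimensional Hilbert space and Φ : B(h) → B(h) a positive linear map. Then the spectral radius r of Φ is an eigenvalue of Φ and there exists a nonzero positive semidefinite x ∈ B(h) with Φ(x) = r x. -/
open Matrix
open scoped ComplexOrder

section

open Filter Topology

/-- The Neumann series of `a` converges on the disc of radius `(spectralRadius ℂ a)⁻¹`. -/
theorem spectrum.hasSum_smul_pow_of_spectralRadius_lt_inv {B : Type*} [NormedRing B]
    [NormedAlgebra ℂ B] [CompleteSpace B] {a : B} {z : ℂ}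
    (hz : (‖z‖₊ : ENNReal) < (spectralRadius ℂ a)⁻¹) :
    HasSum (fun k : ℕ => z ^ k • a ^ k) (Ring.inverse (1 - z • a)) := by
  obtain ⟨r, hzr, hr⟩ := ENNReal.lt_iff_exists_nnreal_btwn.mp hz
  have hr0 : 0 < r := lt_of_le_of_lt zero_le (by exact_mod_cast hzr)
  have H₁ := (spectrum.differentiableOn_inverse_one_sub_smul hr).hasFPowerSeriesOnBall hr0
  have H := ((spectrum.hasFPowerSeriesOnBall_inverse_one_sub_smul ℂ a).exchange_radius H₁).hasSum
    (y := z) (by simpa [Metric.mem_eball, edist_zero_right] using! hzr)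
  simpa using H

variable {A : Type*} [CStarAlgebra A] [PartialOrder A]

/-- Beyond the spectral radius, the Neumann series of a positive map at `1` solves the resolvent
equation. -/
theorem PositiveLinearMap.exists_hasSum_iterate [FiniteDimensional ℂ A] (f : A →ₚ[ℂ] A)
    {r l : ℝ} (hr : 0 ≤ r)
    (hf : ∀ c ∈ spectrum ℂ (f.toLinearMap : Module.End ℂ A), ‖c‖ ≤ r) (hl : r < l) :
    ∃ y : A, HasSum (fun k : ℕ => l⁻¹ ^ k • f^[k] 1) y ∧ f y = l • (y - 1) := by
  have hl0 : 0 < l := hr.trans_lt hl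
  set T : A →L[ℂ] A := Module.End.toContinuousLinearMap A f.toLinearMap with hT
  have hTk (k : ℕ) : (T ^ k) 1 = f^[k] 1 := by rw [FunLike.coe_pow_eq_iterate]; rfl
  have hz : (‖((l⁻¹ : ℝ) : ℂ)‖₊ : ENNReal) < (spectralRadius ℂ T)⁻¹ := by
    have hle : spectralRadius ℂ T ≤ ENNReal.ofReal r := by
      refine iSup₂_le fun c hc => ?_
      rw [hT, AlgEquiv.spectrum_eq] at hc
      rw [← enorm_eq_nnnorm, ← ofReal_norm]
      exact ENNReal.ofReal_le_ofReal (hf c hc)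
    refine lt_of_lt_of_le ?_ (ENNReal.inv_le_inv.mpr hle)
    rw [← enorm_eq_nnnorm, ← ofReal_norm, Complex.norm_of_nonneg (inv_nonneg.mpr hl0.le),
      ENNReal.ofReal_inv_of_pos hl0, ENNReal.inv_lt_inv]
    exact (ENNReal.ofReal_lt_ofReal_iff hl0).mpr hl
  have hs := spectrum.hasSum_smul_pow_of_spectralRadius_lt_inv hz
  have hu := Ring.mul_inverse_cancel _ (spectrum.isUnit_one_sub_smul_of_lt_inv_radius hz)
  generalize Ring.inverse (1 - ((l⁻¹ : ℝ) : ℂ) • T) = R at hs hu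
  refine ⟨R 1, ?_, ?_⟩
  · refine (hs.mapL (ContinuousLinearMap.apply ℂ A (1 : A))).congr_fun fun k => ?_
    rw [← hTk, ← Complex.coe_smul]
    simp
  · have h : R 1 - l⁻¹ • f (R 1) = 1 := by
      rw [← Complex.coe_smul]
      exact congr($hu 1)
    rw [sub_eq_iff_eq_add, ← sub_eq_iff_eq_add', eq_inv_smul_iff₀ hl0.ne'] at h
    exact h.symm

variable [StarOrderedRing A]

open scoped ComplexStarModule

theorem norm_le_two_mul_norm_of_neg_le_of_le {h b : A} (h₁ : -b ≤ h) (h₂ : h ≤ b) :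
    ‖h‖ ≤ 2 * ‖b‖ := by
  have h3 : ‖b + h‖ ≤ ‖b + b‖ := CStarAlgebra.norm_le_norm_of_nonneg_of_le
    (by simpa using add_le_add_right h₁ b) (by gcongr)
  have h4 : ‖b - h‖ ≤ ‖b + b‖ := CStarAlgebra.norm_le_norm_of_nonneg_of_le
    (by simpa using h₂) (by rw [sub_eq_add_neg]; gcongr; exact neg_le.mp h₁)
  have h5 : ‖b + b‖ ≤ ‖b‖ + ‖b‖ := norm_add_le _ _
  have h6 : ‖(2:ℝ) • h‖ ≤ ‖b + h‖ + ‖b - h‖ := by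
    rw [show (2:ℝ) • h = (b + h) - (b - h) by rw [two_smul]; abel]
    exact norm_sub_le _ _
  rw [norm_smul] at h6
  norm_num at h6
  linarith

/-- The orbit of `1` under a positive map dominates the real part of the orbit of any eigenvector. -/
theorem PositiveLinearMap.pow_smul_realPart_le (f : A →ₚ[ℂ] A) {μ : ℂ} (k : ℕ) :
    ∀ {v : A}, f v = μ • v → ‖μ‖ ^ k • (ℜ v : A) ≤ ‖v‖ • f^[k] 1 := by
  obtain ⟨u, hu, hμ⟩ : ∃ u : ℂ, ‖u‖ = 1 ∧ u * μ = ‖μ‖ := by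
    rcases eq_or_ne μ 0 with rfl | h
    · exact ⟨1, by simp⟩
    · exact ⟨‖μ‖ / μ, by simp [h], by field_simp⟩
  induction k with
  | zero =>
    intro v _
    have h := (show IsSelfAdjoint (ℜ v : A) from (ℜ v).2).le_algebraMap_norm_self
    rw [Algebra.algebraMap_eq_smul_one] at h
    simpa using h.trans (smul_le_smul_of_nonneg_right (realPart.norm_le v) zero_le_one)
  | succ k ih =>
    intro v hv
    have h : f (u • v) = μ • u • v := by rw [map_smul, hv, smul_comm]
    have h' := OrderHomClass.mono f (ih h)
    rw [map_smul_of_tower, map_smul_of_tower, map_realPart, map_smul, hv, smul_smul, hμ,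
      Complex.coe_smul, map_smul] at h'
    rw [Function.iterate_succ_apply', pow_succ, mul_smul]
    simpa [norm_smul, hu] using h'

/-- The Neumann series at `1` blows up as `l` tends to the modulus of an eigenvalue. -/
theorem PositiveLinearMap.norm_realPart_le (f : A →ₚ[ℂ] A) {μ : ℂ} {v y : A} {l : ℝ}
    (hv : f v = μ • v) (hl : ‖μ‖ < l) (hy : HasSum (fun k : ℕ => l⁻¹ ^ k • f^[k] 1) y) :
    l * ‖(ℜ v : A)‖ ≤ 2 * ‖v‖ * (l - ‖μ‖) * ‖y‖ := by
  have hl0 : 0 < l := (norm_nonneg μ).trans_lt hl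
  have key {w : A} (hw : f w = μ • w) : (l / (l - ‖μ‖)) • (ℜ w : A) ≤ ‖w‖ • y := by
    have hg := (hasSum_geometric_of_lt_one (r := l⁻¹ * ‖μ‖) (by positivity)
      (by rw [inv_mul_lt_iff₀ hl0]; simpa using hl)).smul_const (ℜ w : A)
    have hgl : (1 - l⁻¹ * ‖μ‖)⁻¹ = l / (l - ‖μ‖) := by
      have : l - ‖μ‖ ≠ 0 := by linarith
      have h1 : 1 - l⁻¹ * ‖μ‖ = (l - ‖μ‖) / l := by field_simp
      rw [h1, inv_div]
    rw [hgl] at hg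
    refine hasSum_le (fun k => ?_) hg (hy.const_smul ‖w‖)
    rw [mul_pow, mul_smul, smul_comm ‖w‖]
    exact smul_le_smul_of_nonneg_left (f.pow_smul_realPart_le k hw) (by positivity)
  have h1 := key hv
  have h2 := key (w := -v) (by rw [map_neg, hv, smul_neg])
  have h3 := norm_le_two_mul_norm_of_neg_le_of_le (by simpa using neg_le_neg h2) h1
  rw [norm_smul, norm_smul, norm_norm, Real.norm_of_nonneg (div_nonneg hl0.le (by linarith)),
    div_mul_eq_mul_div, div_le_iff₀ (by linarith)] at h3
  linarith

/-- The spectral radius of a positive map on a finite-dimensional C⋆-algebra is an eigenvalue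
with a nonnegative eigenvector. -/
theorem PositiveLinearMap.exists_nonneg_eigenvector [FiniteDimensional ℂ A] (f : A →ₚ[ℂ] A) {μ : ℂ}
    (hμ : μ ∈ spectrum ℂ (f.toLinearMap : Module.End ℂ A))
    (hf : ∀ c ∈ spectrum ℂ (f.toLinearMap : Module.End ℂ A), ‖c‖ ≤ ‖μ‖) :
    ∃ x : A, 0 ≤ x ∧ x ≠ 0 ∧ f x = ‖μ‖ • x := by
  obtain ⟨v, hv, hvr⟩ : ∃ v : A, f v = μ • v ∧ (ℜ v : A) ≠ 0 := by
    obtain ⟨v, hv⟩ := (Module.End.hasEigenvalue_iff_mem_spectrum.mpr hμ).exists_hasEigenvector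
    have hv1 : f v = μ • v := hv.apply_eq_smul
    by_cases h : (ℜ v : A) = 0
    · refine ⟨Complex.I • v, by rw [map_smul, hv1, smul_comm], fun h' => hv.2 ?_⟩
      rw [realPart_I_smul] at h'
      rw [← realPart_add_I_smul_imaginaryPart v, h]
      simpa using h'
    · exact ⟨v, hv1, h⟩
  set l : ℕ → ℝ := fun m => ‖μ‖ + 1 / ((m : ℝ) + 1) with hl
  have hlt (m : ℕ) : ‖μ‖ < l m := lt_add_of_pos_right _ Nat.one_div_pos_of_nat
  have hl0 (m : ℕ) : 0 < l m := (norm_nonneg μ).trans_lt (hlt m)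
  have hlim : Tendsto l atTop (𝓝 ‖μ‖) := by
    simpa [hl] using tendsto_one_div_add_atTop_nhds_zero_nat.const_add ‖μ‖
  choose y hy hfy using fun m => f.exists_hasSum_iterate (norm_nonneg μ) hf (hlt m)
  have hy0 (m : ℕ) : 0 ≤ y m := (hy m).nonneg fun k =>
    smul_nonneg (pow_nonneg (inv_nonneg.mpr (hl0 m).le) k)
      (Function.Iterate.rec (fun a : A => 0 ≤ a) zero_le_one (fun _ => f.map_nonneg) k)
  have hbound (m : ℕ) := f.norm_realPart_le hv (hlt m) (hy m)
  have hyn (m : ℕ) : y m ≠ 0 := by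
    intro h
    have := hbound m
    rw [h, norm_zero, mul_zero] at this
    exact this.not_gt (mul_pos (hl0 m) (norm_pos_iff.mpr hvr))
  have hsmall : Tendsto (fun m => l m * ‖y m‖⁻¹) atTop (𝓝 0) := by
    have h0 : Tendsto (fun m => 2 * ‖v‖ * (l m - ‖μ‖) / ‖(ℜ v : A)‖) atTop (𝓝 0) := by
      simpa using ((hlim.sub_const ‖μ‖).const_mul (2 * ‖v‖)).div_const ‖(ℜ v : A)‖
    refine squeeze_zero (fun m => mul_nonneg (hl0 m).le (by positivity)) (fun m => ?_) h0
    rw [← div_eq_mul_inv, div_le_div_iff₀ (norm_pos_iff.mpr (hyn m)) (norm_pos_iff.mpr hvr)]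
    exact hbound m
  have : ProperSpace A := FiniteDimensional.proper ℂ A
  obtain ⟨x, hx, φ, hφ, hlimx⟩ := (isCompact_sphere (0 : A) 1).tendsto_subseq
    (x := fun m => ‖y m‖⁻¹ • y m) fun m => by simp [norm_smul, hyn m]
  refine ⟨x, ?_, ?_, ?_⟩
  · exact CStarAlgebra.isClosed_nonneg.mem_of_tendsto hlimx
      (.of_forall fun m => smul_nonneg (by positivity) (hy0 _))
  · exact ne_zero_of_mem_unit_sphere ⟨x, hx⟩
  · have hstep (m : ℕ) : f (‖y m‖⁻¹ • y m) = l m • (‖y m‖⁻¹ • y m) - (l m * ‖y m‖⁻¹) • 1 := by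
      rw [f.map_smul_of_tower, hfy, smul_comm, smul_sub, smul_sub, mul_smul]
    have hright := ((hlim.comp hφ.tendsto_atTop).smul hlimx).sub
      ((hsmall.comp hφ.tendsto_atTop).smul_const (1 : A))
    rw [zero_smul, sub_zero] at hright
    refine tendsto_nhds_unique (((map_continuous f).tendsto x).comp hlimx) ?_
    exact hright.congr fun m => (hstep (φ m)).symm
end

open scoped MatrixOrder Matrix.Norms.L2Operator in
/-- The matrix form of `PositiveLinearMap.exists_nonneg_eigenvector`. -/
theorem Matrix.exists_posSemidef_eigenvector {n : Type*} [Fintype n] [DecidableEq n]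
    (Φ : Module.End ℂ (Matrix n n ℂ)) (hpos : ∀ x, x.PosSemidef → (Φ x).PosSemidef) {μ : ℂ}
    (hμ : μ ∈ spectrum ℂ Φ) (hΦ : ∀ c ∈ spectrum ℂ Φ, ‖c‖ ≤ ‖μ‖) :
    ∃ x : Matrix n n ℂ, x.PosSemidef ∧ x ≠ 0 ∧ Φ x = (‖μ‖ : ℂ) • x := by
  obtain ⟨x, hx, hx0, hΦx⟩ := (PositiveLinearMap.mk₀ Φ fun x hx =>
    nonneg_iff_posSemidef.mpr (hpos x (nonneg_iff_posSemidef.mp hx))).exists_nonneg_eigenvector hμ hΦ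
  exact ⟨x, nonneg_iff_posSemidef.mp hx, hx0, by rw [Complex.coe_smul]; exact hΦx⟩

/-- Noncommutative Perron–Frobenius theorem: a positive linear map `Φ` on
`n × n` complex matrices has its spectral radius `r` as an eigenvalue, with a
nonzero positive semidefinite eigenvector. -/
theorem perron_frobenius_positive_map {n : ℕ} (hn : 0 < n)
    (Φ : Matrix (Fin n) (Fin n) ℂ →ₗ[ℂ] Matrix (Fin n) (Fin n) ℂ)
    (hpos : ∀ x : Matrix (Fin n) (Fin n) ℂ, x.PosSemidef → (Φ x).PosSemidef) :
    -- `r` is the spectral radius of `Φ`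
    let r : ℝ := sSup ((fun c : ℂ => ‖c‖) ''
      spectrum ℂ (Φ : Module.End ℂ (Matrix (Fin n) (Fin n) ℂ)))
    (r : ℂ) ∈ spectrum ℂ (Φ : Module.End ℂ (Matrix (Fin n) (Fin n) ℂ)) ∧
      ∃ x : Matrix (Fin n) (Fin n) ℂ, x.PosSemidef ∧ x ≠ 0 ∧ Φ x = (r : ℂ) • x := by
  intro r
  have hne : (spectrum ℂ (Φ : Module.End ℂ (Matrix (Fin n) (Fin n) ℂ))).Nonempty := by
    have : Nonempty (Fin n) := ⟨⟨0, hn⟩⟩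
    exact spectrum.nonempty_of_isAlgClosed_of_finiteDimensional ℂ _
  have hfin := (Module.End.finite_spectrum Φ).image (fun c : ℂ => ‖c‖)
  obtain ⟨μ, hμ, hμr⟩ := (hne.image fun c : ℂ => ‖c‖).csSup_mem hfin
  obtain ⟨x, hx, hx0, hΦx⟩ := Matrix.exists_posSemidef_eigenvector Φ hpos hμ
    fun c hc => (le_csSup hfin.bddAbove ⟨c, hc, rfl⟩).trans_eq hμr.symm
  replace hΦx : Φ x = (r : ℂ) • x := by rwa [show ‖μ‖ = r from hμr] at hΦx
  refine ⟨?_, x, hx, hx0, hΦx⟩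
  exact Module.End.hasEigenvalue_iff_mem_spectrum.mp
    (Module.End.hasEigenvalue_of_hasEigenvector
      (Module.End.hasEigenvector_iff.mpr ⟨Module.End.mem_eigenspace_iff.mpr hΦx, hx0⟩))
end

section
/- Let h be a finite-dimensional Hilbert space, T a quantum Markov semigroup on B(h) with generator L, and p₀ a subharmonic projection with p₀^⊥ ≠ 0. Then there exist α ≥ 0 and a state ν with ν = p₀^⊥ ν p₀^⊥, ν ≠ 0, such that p₀^⊥ L_*(ν) p₀^⊥ = -α ν; i.e. a quasi-stationary state with respect to p₀ exists. -/
open Matrix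
open scoped ComplexOrder

/-- A linear map on matrices is completely positive if all of its matrix
amplifications preserve positive semidefiniteness. -/
def IsCompletelyPositive {ι : Type*} [Fintype ι] [DecidableEq ι]
    (Φ : Matrix ι ι ℂ →ₗ[ℂ] Matrix ι ι ℂ) : Prop :=
  ∀ (k : ℕ) (M : Matrix (Fin k × ι) (Fin k × ι) ℂ), M.PosSemidef →
    (Matrix.of fun (p q : Fin k × ι) =>
      Φ (Matrix.of fun a b => M (p.1, a) (q.1, b)) p.2 q.2).PosSemidef

open Filter Topology

/-- A strongly positive linear map on a cone with compact base has an eigenvector in the base,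
by maximising the Collatz-Wielandt number. -/
theorem ConvexCone.exists_eigenvector_of_strongly_positive {V : Type*} [AddCommGroup V]
    [Module ℝ V] [TopologicalSpace V] [IsTopologicalAddGroup V] [ContinuousSMul ℝ V]
    (K : ConvexCone ℝ V) (f : V →ₗ[ℝ] ℝ) (S : V →ₗ[ℝ] V) (hS : Continuous S) (hf : Continuous f)
    (hK : IsClosed (K : Set V)) (hpos : ∀ x ∈ K, x ≠ 0 → 0 < f x)
    (hcomp : IsCompact {x | x ∈ K ∧ f x = 1}) (hne : {x | x ∈ K ∧ f x = 1}.Nonempty)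
    (hSK : ∀ x ∈ K, S x ∈ K)
    (hstrong : ∀ z ∈ K, z ≠ 0 → ∀ y ∈ K, ∃ δ : ℝ, 0 < δ ∧ S z - δ • y ∈ K) :
    ∃ (r : ℝ) (x : V), x ∈ K ∧ f x = 1 ∧ S x = r • x := by
  have hnonneg : ∀ x ∈ K, 0 ≤ f x := fun x hx => by
    by_cases h : x = 0
    · simp [h]
    · exact (hpos x hx h).le
  obtain ⟨R, hR⟩ := (hcomp.image (hf.comp hS)).bddAbove
  have hle : ∀ x, x ∈ K → f x = 1 → ∀ r : ℝ, S x - r • x ∈ K → r ≤ R := fun x hx hx1 r hr => by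
    have h1 := hnonneg _ hr
    have h2 : f (S x) ≤ R := hR ⟨x, ⟨hx, hx1⟩, rfl⟩
    simp only [map_sub, map_smul, hx1, smul_eq_mul, mul_one] at h1
    linarith
  have hP : IsCompact (({x | x ∈ K ∧ f x = 1} ×ˢ Set.Icc 0 R) ∩
      {p : V × ℝ | S p.1 - p.2 • p.1 ∈ K}) :=
    (hcomp.prod isCompact_Icc).inter_right (hK.preimage (by fun_prop))
  obtain ⟨x₀, hx₀, hx₀1⟩ := hne
  have h0 : S x₀ - (0 : ℝ) • x₀ ∈ K := by simpa using hSK x₀ hx₀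
  obtain ⟨⟨x, r⟩, ⟨⟨⟨hx, hx1⟩, hr0, -⟩, hxr⟩, hmax⟩ :=
    hP.exists_isMaxOn ⟨(x₀, 0), ⟨⟨⟨hx₀, hx₀1⟩, le_rfl, hle _ hx₀ hx₀1 _ h0⟩, h0⟩⟩
      continuous_snd.continuousOn
  simp only at hx hx1 hr0
  change S x - r • x ∈ K at hxr
  refine ⟨r, x, hx, hx1, ?_⟩
  by_contra hne
  have hxne : x ≠ 0 := by rintro rfl; simp at hx1
  obtain ⟨δ, hδ, hz⟩ := hstrong _ hxr (sub_ne_zero.2 hne) (S x) (hSK x hx)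
  obtain ⟨δ', hδ', hz'⟩ := hstrong x hx hxne x hx
  have hfS : 0 < f (S x) := by
    have := hnonneg _ hz'
    simp only [map_sub, map_smul, hx1, smul_eq_mul, mul_one] at this
    linarith
  have hc : 0 < (f (S x))⁻¹ := inv_pos.2 hfS
  have hx' : (f (S x))⁻¹ • S x ∈ K := K.smul_mem hc (hSK x hx)
  have hx'1 : f ((f (S x))⁻¹ • S x) = 1 := by
    simp [hfS.ne']
  have hxr' : S ((f (S x))⁻¹ • S x) - (r + δ) • ((f (S x))⁻¹ • S x) ∈ K := by
    have := K.smul_mem hc hz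
    convert this using 1
    simp only [map_sub, map_smul]
    module
  have := hmax (show ((f (S x))⁻¹ • S x, r + δ) ∈ _ from
    ⟨⟨⟨hx', hx'1⟩, by positivity, hle _ hx' hx'1 _ hxr'⟩, hxr'⟩)
  simp only [Set.mem_ofPred_eq] at this
  linarith

section MatrixCone

variable {ι : Type*} [Fintype ι]

section Order

open scoped MatrixOrder Matrix.Norms.L2Operator

theorem Matrix.PosSemidef.trace_smul_one_sub [DecidableEq ι] {x : Matrix ι ι ℂ}
    (hx : x.PosSemidef) : (x.trace.re • (1 : Matrix ι ι ℂ) - x).PosSemidef := by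
  have h : x ≤ algebraMap ℝ _ x.trace.re := by
    refine le_algebraMap_of_spectrum_le (fun a ha => ?_) hx.isHermitian.isSelfAdjoint
    rw [hx.isHermitian.spectrum_real_eq_range_eigenvalues] at ha
    obtain ⟨i, rfl⟩ := ha
    have htr : x.trace.re = ∑ j, hx.isHermitian.eigenvalues j := by
      rw [hx.isHermitian.trace_eq_sum_eigenvalues]
      simp
    rw [htr]
    exact Finset.single_le_sum (fun j _ => hx.eigenvalues_nonneg j) (Finset.mem_univ i)
  rw [← Algebra.algebraMap_eq_smul_one]
  exact Matrix.le_iff.1 h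

theorem Matrix.isClosed_posSemidef : IsClosed {x : Matrix ι ι ℂ | x.PosSemidef} := by
  classical
  simp_rw [← Matrix.nonneg_iff_posSemidef]
  exact CStarAlgebra.isClosed_nonneg

theorem Matrix.isCompact_posSemidef_trace_eq_one :
    IsCompact {x : Matrix ι ι ℂ | x.PosSemidef ∧ x.trace.re = 1} := by
  classical
  have : ProperSpace (Matrix ι ι ℂ) := FiniteDimensional.proper ℂ _
  refine (isCompact_closedBall (0 : Matrix ι ι ℂ) 1).of_isClosed_subset
    (Matrix.isClosed_posSemidef.inter (isClosed_eq (by fun_prop) continuous_const)) ?_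
  rintro x ⟨hx, hx1⟩
  rw [mem_closedBall_zero_iff, CStarAlgebra.norm_le_one_iff_of_nonneg x hx.nonneg, Matrix.le_iff]
  simpa [hx1] using hx.trace_smul_one_sub

end Order

theorem Matrix.PosSemidef.trace_re_pos {x : Matrix ι ι ℂ} (hx : x.PosSemidef) (h : x ≠ 0) :
    0 < x.trace.re := by
  have h0 := Complex.le_def.1 hx.trace_nonneg
  refine lt_of_le_of_ne h0.1 fun h1 => h (hx.trace_eq_zero_iff.1 ?_)
  exact Complex.ext h1.symm h0.2.symm

theorem Matrix.PosSemidef.trace_eq_re {x : Matrix ι ι ℂ} (hx : x.PosSemidef) :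
    x.trace = x.trace.re :=
  Complex.ext rfl (by simpa using (Complex.le_def.1 hx.trace_nonneg).2.symm)

theorem IsCompletelyPositive.posSemidef [DecidableEq ι] {Φ : Matrix ι ι ℂ →ₗ[ℂ] Matrix ι ι ℂ}
    (hΦ : IsCompletelyPositive Φ) {x : Matrix ι ι ℂ} (hx : x.PosSemidef) : (Φ x).PosSemidef :=
  (hΦ 1 _ (hx.submatrix (fun p : Fin 1 × ι => p.2))).submatrix (fun i => ((0 : Fin 1), i))

theorem Matrix.PosSemidef.compress {q x : Matrix ι ι ℂ} (hx : x.PosSemidef)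
    (hq : q.IsHermitian) : (q * x * q).PosSemidef := by
  simpa [hq.eq] using hx.conjTranspose_mul_mul_same q

/-- The cone of positive semidefinite matrices supported in the range of `q`. -/
def Matrix.cornerCone (q : Matrix ι ι ℂ) : ConvexCone ℝ (Matrix ι ι ℂ) where
  carrier := {x | x.PosSemidef ∧ q * x * q = x}
  smul_mem' c hc x hx := ⟨hx.1.smul hc.le, by simp [hx.2]⟩
  add_mem' x hx y hy := ⟨hx.1.add hy.1, by rw [mul_add, add_mul, hx.2, hy.2]⟩

theorem Matrix.mem_cornerCone {q x : Matrix ι ι ℂ} :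
    x ∈ Matrix.cornerCone q ↔ x.PosSemidef ∧ q * x * q = x := Iff.rfl

theorem Matrix.isClosed_cornerCone (q : Matrix ι ι ℂ) :
    IsClosed (Matrix.cornerCone q : Set (Matrix ι ι ℂ)) :=
  Matrix.isClosed_posSemidef.inter
    (isClosed_eq (f := fun x : Matrix ι ι ℂ => q * x * q) (by fun_prop) continuous_id)

/-- Perron-Frobenius for the compression of a positive map to a corner, perturbed by a positive
multiple of `x ↦ tr x • q`. -/
theorem exists_perturbed_corner_eigenvector [DecidableEq ι]
    (Φ : Matrix ι ι ℂ →ₗ[ℂ] Matrix ι ι ℂ)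
    (hΦ : ∀ x, x.PosSemidef → (Φ x).PosSemidef) {q : Matrix ι ι ℂ} (hqq : q * q = q)
    (hq : q.IsHermitian) (hq0 : q ≠ 0) {ε : ℝ} (hε : 0 < ε) :
    ∃ (r : ℝ) (ν : Matrix ι ι ℂ), ν.PosSemidef ∧ ν.trace = 1 ∧ q * ν * q = ν ∧
      q * Φ ν * q + ε • q = r • ν := by
  have hqcorner : q * q * q = q := by rw [hqq, hqq]
  have hqpos : q.PosSemidef := by
    simpa [hqq] using Matrix.PosSemidef.one.compress (q := q) hq
  have hqK : q ∈ cornerCone q := ⟨hqpos, hqcorner⟩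
  have hcompress : ∀ x : Matrix ι ι ℂ, x.PosSemidef → q * x * q ∈ cornerCone q := fun x hx =>
    ⟨hx.compress hq, by
      rw [← mul_assoc, ← mul_assoc, hqq, mul_assoc _ q q, hqq]⟩
  let f : Matrix ι ι ℂ →ₗ[ℝ] ℝ := Complex.reLm ∘ₗ traceLinearMap ι ℝ ℂ
  have hf : ∀ x, f x = x.trace.re := fun x => rfl
  let S : Matrix ι ι ℂ →ₗ[ℝ] Matrix ι ι ℂ :=
    LinearMap.mulLeft ℝ q ∘ₗ LinearMap.mulRight ℝ q ∘ₗ Φ.restrictScalars ℝ +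
      ε • f.smulRight q
  have hSx : ∀ x, S x = q * Φ x * q + (ε * x.trace.re) • q := fun x => by
    simp [S, hf, mul_assoc, smul_smul]
  have hpos : ∀ x ∈ cornerCone q, x ≠ 0 → 0 < f x := fun x hx h => hx.1.trace_re_pos h
  have hcomp : IsCompact {x | x ∈ cornerCone q ∧ f x = 1} := by
    refine Matrix.isCompact_posSemidef_trace_eq_one.of_isClosed_subset
      ((isClosed_cornerCone q).inter
        (isClosed_eq f.continuous_of_finiteDimensional continuous_const)) ?_
    rintro x ⟨hx, hx1⟩
    exact ⟨hx.1, hx1⟩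
  have hne : {x | x ∈ cornerCone q ∧ f x = 1}.Nonempty := by
    have h := hpos q hqK hq0
    exact ⟨(f q)⁻¹ • q, (cornerCone q).smul_mem (inv_pos.2 h) hqK, by simp [h.ne']⟩
  have hSK : ∀ x ∈ cornerCone q, S x ∈ cornerCone q := by
    intro x hx
    rw [hSx]
    by_cases h : x = 0
    · simpa [h, mem_cornerCone] using Matrix.PosSemidef.zero
    · exact (cornerCone q).add_mem (hcompress _ (hΦ x hx.1))
        ((cornerCone q).smul_mem (mul_pos hε (hpos x hx h)) hqK)
  have hstrong : ∀ z ∈ cornerCone q, z ≠ 0 → ∀ y ∈ cornerCone q,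
      ∃ δ : ℝ, 0 < δ ∧ S z - δ • y ∈ cornerCone q := by
    intro z hz hz0 y hy
    have hy0 : 0 ≤ y.trace.re := (Complex.le_def.1 hy.1.trace_nonneg).1
    have hz1 : 0 < z.trace.re := hpos z hz hz0
    have hδ : 0 < ε * z.trace.re / (y.trace.re + 1) := by positivity
    refine ⟨_, hδ, ?_⟩
    have h1 := (cornerCone q).smul_mem hδ
      ((cornerCone q).add_mem (hcompress _ hy.1.trace_smul_one_sub) hqK)
    have h2 := (cornerCone q).add_mem (hcompress _ (hΦ z hz.1)) h1
    convert h2 using 1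
    rw [hSx]
    simp only [mul_sub, sub_mul, hy.2, mul_smul_comm, smul_mul_assoc, mul_one, hqq]
    have h3 : ε * z.trace.re =
        ε * z.trace.re / (y.trace.re + 1) * (y.trace.re + 1) := by field_simp
    generalize ε * z.trace.re / (y.trace.re + 1) = δ at *
    rw [h3]
    module
  obtain ⟨r, ν, ⟨hν, hνq⟩, hν1, hνS⟩ :=
    (cornerCone q).exists_eigenvector_of_strongly_positive f S S.continuous_of_finiteDimensional
      f.continuous_of_finiteDimensional (isClosed_cornerCone q) hpos hcomp hne hSK hstrong
  rw [hf] at hν1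
  refine ⟨r, ν, hν, by rw [hν.trace_eq_re, hν1]; simp, hνq, ?_⟩
  rw [← hνS, hSx, hν1, mul_one]

theorem tendsto_linearMap_apply {α : Type*} [DecidableEq ι] {l : Filter α}
    {D : α → Matrix ι ι ℂ →ₗ[ℂ] Matrix ι ι ℂ} {L : Matrix ι ι ℂ →ₗ[ℂ] Matrix ι ι ℂ}
    (hD : ∀ x, Tendsto (fun a => D a x) l (𝓝 (L x))) {u : α → Matrix ι ι ℂ} {x : Matrix ι ι ℂ}
    (hu : Tendsto u l (𝓝 x)) : Tendsto (fun a => D a (u a)) l (𝓝 (L x)) := by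
  have hsum : ∀ (F : Matrix ι ι ℂ →ₗ[ℂ] Matrix ι ι ℂ) (y : Matrix ι ι ℂ),
      F y = ∑ i, ∑ j, y i j • F (single i j 1) := fun F y => by
    conv_lhs => rw [matrix_eq_sum_single y]
    simp only [map_sum, ← map_smul, smul_single, smul_eq_mul, mul_one]
  simp_rw [hsum _ (u _), hsum L x]
  refine tendsto_finsetSum _ fun i _ => tendsto_finsetSum _ fun j _ => Tendsto.smul ?_ (hD _)
  exact (tendsto_pi_nhds.1 ((tendsto_pi_nhds.1 hu) i)) j

end MatrixCone

/-- Existence of quasi-stationary states in finite dimension: if `T_{t*}` is a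
completely positive trace-preserving semigroup with (bounded) generator `L_*`,
and `p₀` is a subharmonic projection with `p₀^⊥ ≠ 0`, then there exist `α ≥ 0`
and a state `ν` supported in `range p₀^⊥` with `p₀^⊥ L_*(ν) p₀^⊥ = -α ν`. -/
theorem qss_exists {ι : Type*} [Fintype ι] [DecidableEq ι] [Nonempty ι]
    (T : ℝ → Matrix ι ι ℂ →ₗ[ℂ] Matrix ι ι ℂ)
    (L : Matrix ι ι ℂ →ₗ[ℂ] Matrix ι ι ℂ)
    (hT0 : T 0 = LinearMap.id)
    (hsem : ∀ t, 0 ≤ t → ∀ s, 0 ≤ s → T (t + s) = (T t).comp (T s))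
    (hTP : ∀ t, 0 ≤ t → ∀ x : Matrix ι ι ℂ, (T t x).trace = x.trace)
    (hCP : ∀ t, 0 ≤ t → IsCompletelyPositive (T t))
    -- `L` is the generator of `T` (entrywise derivative)
    (hgen : ∀ (x : Matrix ι ι ℂ) (i j : ι) (s : ℝ), 0 ≤ s →
      HasDerivAt (fun t : ℝ => T t x i j) (L (T s x) i j) s)
    (p₀ : Matrix ι ι ℂ) (hproj : p₀ * p₀ = p₀) (hherm : p₀.IsHermitian)
    (hne : (1 : Matrix ι ι ℂ) - p₀ ≠ 0)
    -- `p₀` is subharmonic: states supported in the range of `p₀` stay there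
    (hsub : ∀ t, 0 ≤ t → ∀ ρ : Matrix ι ι ℂ, p₀ * ρ * p₀ = ρ →
      p₀ * T t ρ * p₀ = T t ρ) :
    ∃ (α : ℝ) (ν : Matrix ι ι ℂ), 0 ≤ α ∧
      ν.PosSemidef ∧ ν.trace = 1 ∧ (1 - p₀) * ν * (1 - p₀) = ν ∧
      (1 - p₀) * L ν * (1 - p₀) = (-α : ℂ) • ν := by
  set q : Matrix ι ι ℂ := 1 - p₀ with hqdef
  have hqq : q * q = q := by
    simp only [hqdef, mul_sub, sub_mul, one_mul, mul_one, hproj, sub_self, sub_zero]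
  have hq : q.IsHermitian := Matrix.isHermitian_one.sub hherm
  have hpos : ∀ t, 0 ≤ t → ∀ x : Matrix ι ι ℂ, x.PosSemidef → (T t x).PosSemidef :=
    fun t ht x hx => (hCP t ht).posSemidef hx
  let τ : ℕ → ℝ := fun n => 1 / ((n : ℝ) + 1)
  have hτpos : ∀ n, 0 < τ n := fun n => Nat.one_div_pos_of_nat
  have hτ : Tendsto τ atTop (𝓝 0) := tendsto_one_div_add_atTop_nhds_zero_nat
  choose r u hu hutr huq hur using fun n =>
    exists_perturbed_corner_eigenvector (T (τ n)) (hpos _ (hτpos n).le) hqq hq hne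
      (pow_pos (hτpos n) 2)
  have : FirstCountableTopology (Matrix ι ι ℂ) :=
    inferInstanceAs (FirstCountableTopology (ι → ι → ℂ))
  obtain ⟨ν, ⟨hν, -⟩, φ, hφ, hlim⟩ := Matrix.isCompact_posSemidef_trace_eq_one.tendsto_subseq
    (x := u) fun n => ⟨hu n, by simp [hutr n]⟩
  have hνtr : ν.trace = 1 := by
    refine tendsto_nhds_unique ((continuous_id.matrix_trace.tendsto ν).comp hlim) ?_
    simp [Function.comp_def, hutr]
  have hνq : q * ν * q = ν := by
    refine tendsto_nhds_unique (((by fun_prop :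
      Continuous fun x : Matrix ι ι ℂ => q * x * q).tendsto ν).comp hlim) ?_
    simpa only [Function.comp_def, huq] using hlim
  let σ : ℕ → ℝ := fun n => τ (φ n)
  have hσ : Tendsto σ atTop (𝓝 0) := hτ.comp hφ.tendsto_atTop
  have hσpos : ∀ n, 0 < σ n := fun n => hτpos _
  let D : ℕ → Matrix ι ι ℂ →ₗ[ℂ] Matrix ι ι ℂ := fun n =>
    (((σ n)⁻¹ : ℝ) : ℂ) • (T (σ n) - LinearMap.id)
  have hD : ∀ x, Tendsto (fun n => D n x) atTop (𝓝 (L x)) := fun x => by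
    refine tendsto_pi_nhds.2 fun i => tendsto_pi_nhds.2 fun j => ?_
    have h := hasDerivAt_iff_tendsto_slope_zero.1 (hgen x i j 0 le_rfl)
    have h' := h.comp (tendsto_nhdsWithin_iff.2
      ⟨hσ, Eventually.of_forall fun n => (hσpos n).ne'⟩)
    simpa [Function.comp_def, D, hT0] using h'
  have hDq : ∀ n (x : Matrix ι ι ℂ), q * x * q = x →
      q * D n x * q = (σ n)⁻¹ • (q * T (σ n) x * q - x) := fun n x hx => by
    simp only [D, LinearMap.smul_apply, LinearMap.sub_apply, LinearMap.id_apply, mul_smul_comm,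
      smul_mul_assoc, mul_sub, sub_mul, hx, Complex.coe_smul]
  have hDu : Tendsto (fun n => q * D n (u (φ n)) * q + σ n • q) atTop (𝓝 (q * L ν * q)) := by
    have h := (((by fun_prop : Continuous fun x : Matrix ι ι ℂ => q * x * q).tendsto (L ν)).comp
      (tendsto_linearMap_apply hD hlim)).add (hσ.smul_const q)
    simpa using h
  let β : ℕ → ℝ := fun n => (σ n)⁻¹ * (r (φ n) - 1)
  have hβ : ∀ n, q * D n (u (φ n)) * q + σ n • q = β n • u (φ n) := fun n => by
    have h := hur (φ n)
    have hs := (hσpos n).ne'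
    rw [hDq n _ (huq _), eq_sub_of_add_eq h]
    simp only [β, smul_sub, smul_smul, mul_sub, sub_smul, mul_one]
    rw [show (σ n)⁻¹ * τ (φ n) ^ 2 = σ n by simp only [σ] at hs ⊢; field_simp]
    abel
  simp_rw [hβ] at hDu
  have hβlim : Tendsto β atTop (𝓝 (q * L ν * q).trace.re) := by
    have h := ((Complex.continuous_re.comp continuous_id.matrix_trace).tendsto _).comp hDu
    simpa [Function.comp_def, hutr] using h
  have hνβ : q * L ν * q = (q * L ν * q).trace.re • ν :=
    tendsto_nhds_unique hDu (hβlim.smul hlim)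
  have htrace : ∀ n, (q * D n ν * q).trace.re ≤ 0 := fun n => by
    have h1 : (q * T (σ n) ν * q).trace.re ≤ 1 := by
      have h2 := ((hpos _ (hσpos n).le ν hν).compress hherm).trace_nonneg
      have h3 : (q * T (σ n) ν * q).trace = 1 - (p₀ * T (σ n) ν * p₀).trace := by
        rw [trace_mul_cycle, hqq, trace_mul_cycle p₀, hproj, hqdef, sub_mul, one_mul, trace_sub,
          hTP _ (hσpos n).le, hνtr]
      rw [h3]
      simpa using (Complex.le_def.1 h2).1
    have h4 : (q * D n ν * q).trace.re = (σ n)⁻¹ * ((q * T (σ n) ν * q).trace.re - 1) := by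
      rw [hDq n ν hνq]
      simp [hνtr]
    rw [h4]
    exact mul_nonpos_of_nonneg_of_nonpos (inv_pos.2 (hσpos n)).le (by linarith)
  have hle : (q * L ν * q).trace.re ≤ 0 :=
    le_of_tendsto' (((by fun_prop :
      Continuous fun x : Matrix ι ι ℂ => (q * x * q).trace.re).tendsto (L ν)).comp (hD ν)) htrace
  refine ⟨-(q * L ν * q).trace.re, ν, by linarith, hν, hνtr, hνq, ?_⟩
  conv_lhs => rw [hνβ]
  simp
end

section
/- Let Φ : M_n(ℂ) → M_n(ℂ) be an irreducible positive linear map, i.e. there is no nontrivial orthogonal projection p and constant a ≥ 0 with Φ(p) ≤ a p. Then the spectral radius r of Φ is a geometrically simple eigenvalue, and the corresponding positive eigenvector x (with Φ(x) = r x, x ≥ 0) is strictly positive (invertible) and is, up to scalar, the unique positive semidefinite eigenvector of Φ. -/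
open Matrix
open scoped ComplexOrder

section MatrixOrderFacts

variable {ι : Type*}

lemma posSemidef_ofReal_smul {A : Matrix ι ι ℂ} (hA : A.PosSemidef) {t : ℝ} (ht : 0 ≤ t) :
    ((t : ℂ) • A).PosSemidef :=
  hA.smul (Complex.zero_le_real.2 ht)

lemma eq_of_posSemidef_sub {A B : Matrix ι ι ℂ} (h₁ : (A - B).PosSemidef)
    (h₂ : (B - A).PosSemidef) : A = B := by
  open scoped MatrixOrder in exact le_antisymm (Matrix.le_iff.2 h₂) (Matrix.le_iff.2 h₁)

variable [Fintype ι]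

lemma isClosed_setOf_posSemidef : IsClosed {A : Matrix ι ι ℂ | A.PosSemidef} := by
  simp only [posSemidef_iff_dotProduct_mulVec, Set.ofPred_and, Set.ofPred_forall]
  refine IsClosed.inter ?_ (isClosed_iInter fun v => ?_)
  · exact isClosed_eq (by fun_prop) continuous_id
  · exact isClosed_le continuous_const (by fun_prop)

lemma Matrix.PosSemidef.trace_re_pos_s16 {A : Matrix ι ι ℂ} (hA : A.PosSemidef) (h : A ≠ 0) :
    0 < A.trace.re ∧ A.trace = (A.trace.re : ℂ) := by
  obtain ⟨h₁, h₂⟩ := Complex.nonneg_iff.1 hA.trace_nonneg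
  have h₃ : A.trace = (A.trace.re : ℂ) := Complex.ext rfl (by simpa using h₂.symm)
  refine ⟨h₁.lt_of_ne fun h₀ => h (hA.trace_eq_zero_iff.1 ?_), h₃⟩
  rw [h₃, ← h₀, Complex.ofReal_zero]

variable [DecidableEq ι]

lemma Matrix.IsHermitian.exists_unitary_diagonalization {A : Matrix ι ι ℂ} (hA : A.IsHermitian) :
    ∃ U : Matrix ι ι ℂ, Uᴴ * U = 1 ∧ U * Uᴴ = 1 ∧
      A = U * diagonal (fun i => (hA.eigenvalues i : ℂ)) * Uᴴ := by
  refine ⟨hA.eigenvectorUnitary.1, Unitary.coe_star_mul_self _, Unitary.coe_mul_star_self _, ?_⟩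
  conv_lhs => rw [hA.spectral_theorem, Unitary.conjStarAlgAut_apply]
  rfl

/-- A positive semidefinite matrix is comparable, in both directions, with the orthogonal
projection onto its range. -/
lemma exists_supportProjection {A : Matrix ι ι ℂ} (hA : A.PosSemidef) :
    ∃ P : Matrix ι ι ℂ, P * P = P ∧ P.IsHermitian ∧ A * P = A ∧
      ∃ C : ℝ, 0 ≤ C ∧ ((C : ℂ) • A - P).PosSemidef := by
  obtain ⟨U, hUU, -, hspec⟩ := hA.1.exists_unitary_diagonalization
  set d := hA.1.eigenvalues
  set e : ι → ℂ := fun i => if d i = 0 then 0 else 1 with he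
  have hmul (f g : ι → ℂ) : (U * diagonal f * Uᴴ) * (U * diagonal g * Uᴴ) =
      U * diagonal (f * g) * Uᴴ := by
    calc _ = U * diagonal f * (Uᴴ * U) * diagonal g * Uᴴ := by simp only [Matrix.mul_assoc]
      _ = _ := by rw [hUU, Matrix.mul_one, Matrix.mul_assoc U, diagonal_mul_diagonal]; rfl
  refine ⟨U * diagonal e * Uᴴ, ?_, ?_, ?_, ∑ i, (d i)⁻¹, ?_, ?_⟩
  · rw [hmul]
    congr 3
    ext i
    by_cases h : d i = 0 <;> simp [he, h]
  · refine isHermitian_mul_mul_conjTranspose U (isHermitian_diagonal_of_self_adjoint _ ?_)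
    ext i
    by_cases h : d i = 0 <;> simp [he, h]
  · conv_lhs => rw [hspec, hmul]
    conv_rhs => rw [hspec]
    congr 3
    ext i
    by_cases h : d i = 0 <;> simp [he, h]
  · exact Finset.sum_nonneg fun i _ => inv_nonneg.2 (hA.eigenvalues_nonneg i)
  · have : (((∑ i, (d i)⁻¹ : ℝ) : ℂ) • A - U * diagonal e * Uᴴ) =
        U * diagonal (fun i => (((∑ j, (d j)⁻¹) * d i - if d i = 0 then 0 else 1 : ℝ) : ℂ))
          * Uᴴ := by
      conv_lhs => rw [hspec]
      rw [← Matrix.smul_mul, ← Matrix.mul_smul, ← Matrix.sub_mul, ← Matrix.mul_sub,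
        ← diagonal_smul, diagonal_sub]
      congr 3
      ext i
      by_cases h : d i = 0 <;> simp [he, h]
    rw [this]
    refine (PosSemidef.diagonal fun i => Complex.zero_le_real.2 ?_).mul_mul_conjTranspose_same U
    have hdi : 0 ≤ d i := hA.eigenvalues_nonneg i
    by_cases h : d i = 0
    · simp [h]
    · have : (d i)⁻¹ ≤ ∑ j, (d j)⁻¹ :=
        Finset.single_le_sum (fun j _ => inv_nonneg.2 (hA.eigenvalues_nonneg j))
          (Finset.mem_univ i)
      have := mul_le_mul_of_nonneg_right this hdi
      rw [inv_mul_cancel₀ h] at this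
      simpa [h] using this

lemma exists_smul_one_sub_posSemidef {B : Matrix ι ι ℂ} (hB : B.IsHermitian) :
    ∃ M : ℝ, 0 ≤ M ∧ ((M : ℂ) • 1 - B).PosSemidef := by
  obtain ⟨U, -, hUU, hspec⟩ := hB.exists_unitary_diagonalization
  set d := hB.eigenvalues
  refine ⟨∑ i, |d i|, Finset.sum_nonneg fun i _ => abs_nonneg _, ?_⟩
  have : (((∑ i, |d i| : ℝ) : ℂ) • 1 - B) =
      U * diagonal (fun i => (((∑ j, |d j|) - d i : ℝ) : ℂ)) * Uᴴ := by
    have hone : (1 : Matrix ι ι ℂ) = U * diagonal (fun _ => 1) * Uᴴ := by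
      rw [diagonal_one, Matrix.mul_one, hUU]
    conv_lhs => rw [hspec, hone]
    rw [← Matrix.smul_mul, ← Matrix.mul_smul, ← Matrix.sub_mul,
      ← Matrix.mul_sub, ← diagonal_smul, diagonal_sub]
    congr 3
    ext i
    simp
  rw [this]
  refine (PosSemidef.diagonal fun i => Complex.zero_le_real.2 ?_).mul_mul_conjTranspose_same U
  have : |d i| ≤ ∑ j, |d j| :=
    Finset.single_le_sum (f := fun j => |d j|) (fun j _ => abs_nonneg _) (Finset.mem_univ i)
  linarith [le_abs_self (d i)]

lemma exists_smul_sub_posSemidef_of_mul_eq {P B : Matrix ι ι ℂ} (hP : P * P = P)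
    (hPH : P.IsHermitian) (hB : B.IsHermitian) (hBP : B * P = B) :
    ∃ M : ℝ, 0 ≤ M ∧ ((M : ℂ) • P - B).PosSemidef := by
  obtain ⟨M, hM, h⟩ := exists_smul_one_sub_posSemidef hB
  refine ⟨M, hM, ?_⟩
  have hPB : P * B = B := by
    simpa [conjTranspose_mul, hPH.eq, hB.eq] using congrArg conjTranspose hBP
  convert h.conjTranspose_mul_mul_same P using 1
  rw [hPH.eq, Matrix.mul_sub, Matrix.sub_mul, Matrix.mul_smul, Matrix.smul_mul, Matrix.mul_one,
    hP, hPB, hBP]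

/-- A Hermitian matrix whose kernel contains that of the positive semidefinite matrix `A` is
dominated by a multiple of `A`. -/
lemma exists_smul_sub_posSemidef {A B : Matrix ι ι ℂ} (hA : A.PosSemidef) (hB : B.IsHermitian)
    (hker : ∀ v, A *ᵥ v = 0 → B *ᵥ v = 0) :
    ∃ M : ℝ, 0 ≤ M ∧ ((M : ℂ) • A - B).PosSemidef := by
  obtain ⟨P, hP, hPH, hAP, C, hC, hCP⟩ := exists_supportProjection hA
  have hBP : B * P = B := by
    refine Matrix.ext_of_mulVec_single fun i => ?_
    have := hker ((1 - P) *ᵥ Pi.single i 1) (by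
      rw [mulVec_mulVec, Matrix.mul_sub, hAP, Matrix.mul_one, sub_self, zero_mulVec])
    rw [mulVec_mulVec, Matrix.mul_sub, Matrix.mul_one, Matrix.sub_mulVec] at this
    exact (sub_eq_zero.1 this).symm
  obtain ⟨M, hM, h⟩ := exists_smul_sub_posSemidef_of_mul_eq hP hPH hB hBP
  refine ⟨M * C, mul_nonneg hM hC, ?_⟩
  convert (posSemidef_ofReal_smul hCP hM).add h using 1
  push_cast
  module

lemma Matrix.PosDef.exists_smul_sub_posSemidef {A B : Matrix ι ι ℂ} (hA : A.PosDef)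
    (hB : B.IsHermitian) : ∃ M : ℝ, 0 ≤ M ∧ ((M : ℂ) • A - B).PosSemidef := by
  refine _root_.exists_smul_sub_posSemidef hA.posSemidef hB fun v hv => ?_
  have : v = 0 := by
    by_contra h
    simpa [hv] using hA.dotProduct_mulVec_pos h
  simp [this]

lemma Matrix.PosDef.exists_sub_smul_posSemidef {A B : Matrix ι ι ℂ} (hA : A.PosDef)
    (hB : B.IsHermitian) : ∃ ε : ℝ, 0 < ε ∧ (A - (ε : ℂ) • B).PosSemidef := by
  obtain ⟨M, hM, h⟩ := hA.exists_smul_sub_posSemidef hB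
  refine ⟨(M + 1)⁻¹, by positivity, ?_⟩
  convert posSemidef_ofReal_smul (h.add hA.posSemidef) (t := (M + 1)⁻¹) (by positivity) using 1
  have : ((M : ℂ) + 1) ≠ 0 := by exact_mod_cast (by positivity : M + 1 ≠ 0)
  push_cast
  match_scalars <;> field_simp

lemma isCompact_posSemidef_trace_one :
    IsCompact {A : Matrix ι ι ℂ | A.PosSemidef ∧ A.trace = 1} := by
  have hK : IsCompact {B : Matrix ι ι ℂ | (Bᴴ * B).trace = 1} := by
    refine (isCompact_univ_pi fun _ : ι => isCompact_univ_pi fun _ : ι =>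
      isCompact_closedBall (0 : ℂ) 1).of_isClosed_subset
        (isClosed_eq (by fun_prop) continuous_const) fun (B : Matrix ι ι ℂ) hB i _ j _ => ?_
    have h : ∑ j, ∑ i, ‖B i j‖ ^ 2 = 1 := by
      have h' : (Bᴴ * B).trace = ((∑ j, ∑ i, ‖B i j‖ ^ 2 : ℝ) : ℂ) := by
        simp [trace, mul_apply, Complex.conj_mul']
      exact_mod_cast h'.symm.trans hB
    have h₁ : ‖B i j‖ ^ 2 ≤ ∑ i, ‖B i j‖ ^ 2 :=
      Finset.single_le_sum (f := fun i => ‖B i j‖ ^ 2) (fun _ _ => by positivity)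
        (Finset.mem_univ i)
    have h₂ : ∑ i, ‖B i j‖ ^ 2 ≤ ∑ j, ∑ i, ‖B i j‖ ^ 2 :=
      Finset.single_le_sum (f := fun j => ∑ i, ‖B i j‖ ^ 2) (fun _ _ => by positivity)
        (Finset.mem_univ j)
    rw [mem_closedBall_zero_iff]
    nlinarith [norm_nonneg (B i j)]
  convert hK.image (f := fun B : Matrix ι ι ℂ => Bᴴ * B) (by fun_prop) using 1
  ext A
  constructor
  · rintro ⟨hA, htr⟩
    obtain ⟨B, rfl⟩ : ∃ B : Matrix ι ι ℂ, A = Bᴴ * B := by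
      open scoped MatrixOrder in
      exact CStarAlgebra.nonneg_iff_eq_star_mul_self.1 hA.nonneg
    exact ⟨B, htr, rfl⟩
  · rintro ⟨B, hB, rfl⟩
    exact ⟨posSemidef_conjTranspose_mul_self B, hB⟩

end MatrixOrderFacts

lemma one_add_pow_succ_apply {R M : Type*} [Semiring R] [AddCommMonoid M] [Module R M]
    (f : Module.End R M) (w : M) (k : ℕ) :
    ((1 + f) ^ (k + 1)) w = ((1 + f) ^ k) w + f (((1 + f) ^ k) w) := by
  rw [pow_succ', Module.End.mul_apply]
  rfl

section PositiveMaps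

variable {ι : Type*} [Fintype ι]

/-- A linear map is positive if it preserves the cone of positive semidefinite matrices. -/
def IsPositiveMap (Φ : Matrix ι ι ℂ →ₗ[ℂ] Matrix ι ι ℂ) : Prop :=
  ∀ x : Matrix ι ι ℂ, x.PosSemidef → (Φ x).PosSemidef

variable {Φ : Matrix ι ι ℂ →ₗ[ℂ] Matrix ι ι ℂ}

lemma IsPositiveMap.one_add_pow_apply (hΦ : IsPositiveMap Φ) {w : Matrix ι ι ℂ}
    (hw : w.PosSemidef) (hw0 : w ≠ 0) (k : ℕ) :
    (((1 + Φ : Module.End ℂ (Matrix ι ι ℂ)) ^ k) w).PosSemidef ∧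
      ((1 + Φ : Module.End ℂ (Matrix ι ι ℂ)) ^ k) w ≠ 0 := by
  induction k with
  | zero => simpa using ⟨hw, hw0⟩
  | succ k ih =>
    rw [one_add_pow_succ_apply]
    refine ⟨ih.1.add (hΦ _ ih.1), fun h => ?_⟩
    have h₁ := (ih.1.trace_re_pos_s16 ih.2).1
    have h₂ := (Complex.nonneg_iff.1 (hΦ _ ih.1).trace_nonneg).1
    have h₃ := congrArg (fun A => (trace A).re) h
    simp only [trace_add, Complex.add_re, trace_zero, Complex.zero_re] at h₃
    linarith

variable [DecidableEq ι]

/-- The only orthogonal projections `p` with `Φ p ≤ a p` for some `a ≥ 0` are `0` and `1`. -/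
def IsIrreducibleMap (Φ : Matrix ι ι ℂ →ₗ[ℂ] Matrix ι ι ℂ) : Prop :=
  ∀ (p : Matrix ι ι ℂ) (a : ℝ), 0 ≤ a → p * p = p → p.IsHermitian →
    ((a : ℂ) • p - Φ p).PosSemidef → p = 0 ∨ p = 1

namespace IsPositiveMap

lemma isHermitian (hΦ : IsPositiveMap Φ) {B : Matrix ι ι ℂ} (hB : B.IsHermitian) :
    (Φ B).IsHermitian := by
  obtain ⟨M, hM, h⟩ := exists_smul_one_sub_posSemidef hB
  convert (hΦ _ (posSemidef_ofReal_smul PosSemidef.one hM)).1.sub (hΦ _ h).1 using 1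
  rw [← map_sub, sub_sub_cancel]

lemma map_conjTranspose (hΦ : IsPositiveMap Φ) (B : Matrix ι ι ℂ) : Φ Bᴴ = (Φ B)ᴴ := by
  have h₁ := (hΦ.isHermitian (isHermitian_add_transpose_self B)).eq
  have h₂ := (hΦ.isHermitian (B := Complex.I • (B - Bᴴ)) (by
    simp [IsHermitian, conjTranspose_smul, ← smul_neg])).eq
  simp only [map_add, map_smul, map_sub, conjTranspose_add, conjTranspose_smul,
    conjTranspose_sub] at h₁ h₂
  have h₃ := congrArg (Complex.I • ·) h₂
  simp only [RCLike.star_def, Complex.conj_I, smul_smul, Complex.I_mul_I, smul_neg, neg_neg,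
    one_smul, neg_smul] at h₃
  have h₄ : (2 : ℂ) • Φ Bᴴ = (2 : ℂ) • (Φ B)ᴴ := by
    linear_combination (norm := module) (-1 : ℂ) • h₁ + (-1 : ℂ) • h₃
  exact smul_right_injective _ two_ne_zero h₄

lemma eq_zero_of_map_eq_smul (hΦ : IsPositiveMap Φ) {x y : Matrix ι ι ℂ} (hx : x.PosDef) {s : ℝ}
    (hs : 0 ≤ s) (hxs : Φ x = (s : ℂ) • x) {c : ℂ} (hy : Φ y = c • y) (hsc : s < ‖c‖) :
    y = 0 := by
  have hc : 0 < ‖c‖ := hs.trans_lt hsc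
  have hc0 : c ≠ 0 := norm_pos_iff.1 hc
  have hc0' : (‖c‖ : ℂ) ≠ 0 := by exact_mod_cast hc.ne'
  set h : ℂ → Matrix ι ι ℂ := fun z => z • y + (z • y)ᴴ with hh
  have hherm (z : ℂ) : (h z).IsHermitian := isHermitian_add_transpose_self _
  have hmap (z : ℂ) : Φ (h z) = h (c * z) := by
    simp only [hh, map_add, hΦ.map_conjTranspose, map_smul, hy, smul_smul, mul_comm]
  have hbound (w : ℂ) : ∃ M : ℝ, 0 ≤ M ∧
      ∀ t : ℝ, (((|t| * M : ℝ) : ℂ) • x + (t : ℂ) • h w).PosSemidef := by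
    obtain ⟨M₁, hM₁, h₁⟩ := hx.exists_smul_sub_posSemidef (hherm w)
    obtain ⟨M₂, hM₂, h₂⟩ := hx.exists_smul_sub_posSemidef (hherm w).neg
    refine ⟨M₁ + M₂, by positivity, fun t => ?_⟩
    rcases le_total 0 t with ht | ht
    · convert (posSemidef_ofReal_smul h₂ ht).add
        (posSemidef_ofReal_smul hx.posSemidef (mul_nonneg ht hM₁)) using 1
      rw [abs_of_nonneg ht]
      push_cast
      module
    · have ht' := neg_nonneg.2 ht
      convert (posSemidef_ofReal_smul h₁ ht').add
        (posSemidef_ofReal_smul hx.posSemidef (mul_nonneg ht' hM₂)) using 1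
      rw [abs_of_nonpos ht]
      push_cast
      module
  obtain ⟨M₁, hM₁, h₁⟩ := hbound 1
  obtain ⟨M₂, hM₂, h₂⟩ := hbound Complex.I
  have hiter (k : ℕ) : ∀ z : ℂ,
      (((‖z‖ * (M₁ + M₂) * (s / ‖c‖) ^ k : ℝ) : ℂ) • x + h z).PosSemidef := by
    induction k with
    | zero =>
      intro z
      have e₁ : 0 ≤ (‖z‖ - |z.re|) * M₁ :=
        mul_nonneg (sub_nonneg.2 (Complex.abs_re_le_norm z)) hM₁
      have e₂ : 0 ≤ (‖z‖ - |z.im|) * M₂ :=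
        mul_nonneg (sub_nonneg.2 (Complex.abs_im_le_norm z)) hM₂
      have hz : h z = (z.re : ℂ) • h 1 + (z.im : ℂ) • h Complex.I := by
        conv_lhs => rw [← Complex.re_add_im z]
        simp only [hh, conjTranspose_smul, RCLike.star_def, Complex.conj_I, map_add, map_mul,
          Complex.conj_ofReal, map_one]
        module
      convert ((h₁ z.re).add (h₂ z.im)).add
        (posSemidef_ofReal_smul hx.posSemidef (add_nonneg e₁ e₂)) using 1
      rw [hz]
      push_cast
      module
    | succ k ih =>
      intro z
      convert hΦ _ (ih (z / c)) using 1
      rw [map_add, hmap, map_smul, hxs, mul_div_cancel₀ _ hc0, norm_div, smul_smul]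
      congr 2
      push_cast
      rw [pow_succ]
      field_simp
  have hnonneg (z : ℂ) : (h z).PosSemidef := by
    have hq : Filter.Tendsto (fun k : ℕ => (s / ‖c‖) ^ k) Filter.atTop (nhds 0) :=
      tendsto_pow_atTop_nhds_zero_of_lt_one (by positivity) ((div_lt_one hc).2 hsc)
    have hlim : Filter.Tendsto
        (fun k : ℕ => ((‖z‖ * (M₁ + M₂) * (s / ‖c‖) ^ k : ℝ) : ℂ) • x + h z)
        Filter.atTop (nhds (((‖z‖ * (M₁ + M₂) * 0 : ℝ) : ℂ) • x + h z)) :=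
      (((Complex.continuous_ofReal.tendsto _).comp (hq.const_mul _)).smul_const x).add_const _
    have := isClosed_setOf_posSemidef.mem_of_tendsto hlim (.of_forall fun k => hiter k z)
    simpa using this
  have hzero (z : ℂ) : h z = 0 := by
    refine eq_of_posSemidef_sub (by simpa using hnonneg z) ?_
    convert hnonneg (-z) using 1
    simp [hh, add_comm]
  have e₁ := hzero 1
  have e₂ := congrArg (-Complex.I • ·) (hzero Complex.I)
  simp only [hh, one_smul, conjTranspose_smul, RCLike.star_def, Complex.conj_I, smul_add, smul_smul,
    smul_zero, neg_mul, smul_neg, map_one, Complex.I_mul_I, neg_neg, neg_smul] at e₁ e₂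
  have : (2 : ℂ) • y = 0 := by
    linear_combination (norm := module) e₁ + e₂
  exact (smul_eq_zero.1 this).resolve_left two_ne_zero

end IsPositiveMap

lemma IsIrreducibleMap.posDef_of_smul_sub (hΦ : IsPositiveMap Φ) (hirr : IsIrreducibleMap Φ)
    {w : Matrix ι ι ℂ} (hw : w.PosSemidef) (hw0 : w ≠ 0) {c : ℝ} (hc : 0 ≤ c)
    (h : ((c : ℂ) • w - Φ w).PosSemidef) : w.PosDef := by
  obtain ⟨P, hP, hPH, hwP, C, hC, hCP⟩ := exists_supportProjection hw
  obtain ⟨M, hM, hMP⟩ := exists_smul_sub_posSemidef_of_mul_eq hP hPH hw.1 hwP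
  have hPP : (((C * c * M : ℝ) : ℂ) • P - Φ P).PosSemidef := by
    convert ((hΦ _ hCP).add (posSemidef_ofReal_smul h hC)).add
      (posSemidef_ofReal_smul hMP (mul_nonneg hC hc)) using 1
    rw [map_sub, map_smul]
    push_cast
    module
  rcases hirr P _ (by positivity) hP hPH hPP with rfl | rfl
  · exact absurd (by simpa using hwP.symm) hw0
  · have h₁ : (((C + 1 : ℝ) : ℂ) • w).PosDef := by
      convert (PosDef.one.add_posSemidef hCP).add_posSemidef hw using 1
      push_cast
      module
    have hC1 : 0 < C + 1 := by positivity
    convert h₁.smul (Complex.zero_lt_real.2 (inv_pos.2 hC1)) using 1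
    rw [smul_smul, ← Complex.ofReal_mul, inv_mul_cancel₀ hC1.ne', Complex.ofReal_one, one_smul]

/-- Kernels of the iterates of `1 + Φ` stabilise, and at that stage the iterate dominates a
multiple of its image, so irreducibility makes it positive definite. -/
lemma IsIrreducibleMap.exists_pow_posDef (hΦ : IsPositiveMap Φ) (hirr : IsIrreducibleMap Φ)
    {w : Matrix ι ι ℂ} (hw : w.PosSemidef) (hw0 : w ≠ 0) :
    ∃ k : ℕ, (((1 + Φ : Module.End ℂ (Matrix ι ι ℂ)) ^ k) w).PosDef := by
  have hsucc := one_add_pow_succ_apply Φ w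
  have hpsd k := (hΦ.one_add_pow_apply hw hw0 k).1
  have hne k := (hΦ.one_add_pow_apply hw hw0 k).2
  set T : Module.End ℂ (Matrix ι ι ℂ) := 1 + Φ
  have hker (k : ℕ) (v : ι → ℂ) (hv : (T ^ (k + 1)) w *ᵥ v = 0) : (T ^ k) w *ᵥ v = 0 := by
    rw [hsucc, add_mulVec] at hv
    rw [← (hpsd k).dotProduct_mulVec_zero_iff]
    have h₁ := (hpsd k).dotProduct_mulVec_nonneg v
    have h₂ := (hΦ _ (hpsd k)).dotProduct_mulVec_nonneg v
    have h₃ := congrArg (star v ⬝ᵥ ·) hv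
    simp only [dotProduct_add, dotProduct_zero] at h₃
    exact ((add_eq_zero_iff_of_nonneg h₁ h₂).1 h₃).1
  let K : ℕ →o (Submodule ℂ (ι → ℂ))ᵒᵈ :=
    { toFun := fun k => OrderDual.toDual (LinearMap.ker ((T ^ k) w).mulVecLin)
      monotone' := monotone_nat_of_le_succ fun k v hv =>
        LinearMap.mem_ker.2 (hker k v (LinearMap.mem_ker.1 hv)) }
  obtain ⟨k, hk⟩ := IsArtinian.monotone_stabilizes K
  have hK : LinearMap.ker ((T ^ k) w).mulVecLin = LinearMap.ker ((T ^ (k + 1)) w).mulVecLin :=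
    hk (k + 1) k.le_succ
  obtain ⟨C, hC, h⟩ := exists_smul_sub_posSemidef (hpsd k) (hpsd (k + 1)).1 fun v hv => by
    have : v ∈ LinearMap.ker ((T ^ k) w).mulVecLin := by simpa using hv
    rw [hK] at this
    simpa using this
  refine ⟨k, hirr.posDef_of_smul_sub hΦ (hpsd k) (hne k) hC ?_⟩
  convert h.add (hpsd k) using 1
  rw [hsucc]
  module

/-- The largest `t` such that `t x ≤ Φ x` for some nonzero `x ≥ 0` is an eigenvalue. -/
lemma IsIrreducibleMap.exists_posDef_eigenvector [Nonempty ι] (hΦ : IsPositiveMap Φ)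
    (hirr : IsIrreducibleMap Φ) :
    ∃ s : ℝ, 0 ≤ s ∧ ∃ x : Matrix ι ι ℂ, x.PosDef ∧ Φ x = (s : ℂ) • x := by
  have hΦc : Continuous Φ := Φ.continuous_of_finiteDimensional
  set S := {A : Matrix ι ι ℂ | A.PosSemidef ∧ A.trace = 1}
  have hScpt : IsCompact S := isCompact_posSemidef_trace_one
  have hnormalize {x : Matrix ι ι ℂ} (hx : x.PosSemidef) (hx0 : x ≠ 0) :
      ((x.trace.re⁻¹ : ℝ) : ℂ) • x ∈ S := by
    obtain ⟨h₁, h₂⟩ := hx.trace_re_pos_s16 hx0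
    refine ⟨posSemidef_ofReal_smul hx (inv_nonneg.2 h₁.le), ?_⟩
    rw [trace_smul, h₂, Complex.ofReal_re, smul_eq_mul, ← Complex.ofReal_mul,
      inv_mul_cancel₀ h₁.ne', Complex.ofReal_one]
  obtain ⟨B, hB⟩ := hScpt.bddAbove_image (f := fun x => (Φ x).trace.re)
    (Continuous.continuousOn (by fun_prop))
  have hbound {t : ℝ} {x : Matrix ι ι ℂ} (hx : x ∈ S) (h : (Φ x - (t : ℂ) • x).PosSemidef) :
      t ≤ B := by
    have h₁ := (Complex.nonneg_iff.1 h.trace_nonneg).1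
    rw [trace_sub, trace_smul, hx.2, smul_eq_mul, mul_one, Complex.sub_re, Complex.ofReal_re]
      at h₁
    have h₂ : (Φ x).trace.re ≤ B := hB ⟨x, hx, rfl⟩
    linarith
  set K := (Set.Icc 0 B ×ˢ S) ∩ {q : ℝ × Matrix ι ι ℂ | (Φ q.2 - (q.1 : ℂ) • q.2).PosSemidef}
  have hKcpt : IsCompact K := (isCompact_Icc.prod hScpt).inter_right
    (isClosed_setOf_posSemidef.preimage (by fun_prop))
  have hKmem {t : ℝ} (ht : 0 ≤ t) {x : Matrix ι ι ℂ} (hx : x.PosSemidef) (hx0 : x ≠ 0)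
      (h : (Φ x - (t : ℂ) • x).PosSemidef) : ∃ x', (t, x') ∈ K := by
    have hmem := hnormalize hx hx0
    have h' : (Φ (((x.trace.re⁻¹ : ℝ) : ℂ) • x) -
        (t : ℂ) • ((x.trace.re⁻¹ : ℝ) : ℂ) • x).PosSemidef := by
      convert posSemidef_ofReal_smul h (inv_nonneg.2 (hx.trace_re_pos_s16 hx0).1.le) using 1
      rw [map_smul]
      module
    exact ⟨_, ⟨⟨ht, hbound hmem h'⟩, hmem⟩, h'⟩
  have hKne : K.Nonempty := by
    obtain ⟨x, hx⟩ := hKmem le_rfl PosSemidef.one one_ne_zero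
      (by simpa using hΦ 1 PosSemidef.one)
    exact ⟨_, hx⟩
  obtain ⟨⟨s, x⟩, ⟨⟨⟨hs, -⟩, hx⟩, hsx⟩, hmax⟩ :=
    hKcpt.exists_isMaxOn hKne continuous_fst.continuousOn
  have hx0 : x ≠ 0 := by
    rintro rfl
    simpa using hx.2
  have hΦx : Φ x = (s : ℂ) • x := by
    by_contra hne
    obtain ⟨k, hk⟩ := hirr.exists_pow_posDef hΦ hsx (sub_ne_zero.2 hne)
    have hTx := hΦ.one_add_pow_apply hx.1 hx0 k
    set T : Module.End ℂ (Matrix ι ι ℂ) := (1 + Φ) ^ k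
    have hcomm (y : Matrix ι ι ℂ) : T (Φ y) = Φ (T y) := by
      have : Commute T Φ := ((Commute.one_left _).add_left (Commute.refl _)).pow_left k
      exact LinearMap.congr_fun this.eq y
    obtain ⟨ε, hε, h⟩ := hk.exists_sub_smul_posSemidef hTx.1.1
    obtain ⟨x', hx'⟩ := hKmem (add_nonneg hs hε.le) hTx.1 hTx.2 (by
      convert h using 1
      rw [map_sub, map_smul, hcomm]
      push_cast
      module)
    have : s + ε ≤ s := hmax hx'
    linarith
  exact ⟨s, hs, x, hirr.posDef_of_smul_sub hΦ hx.1 hx0 hs (by simp [hΦx, PosSemidef.zero]), hΦx⟩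

lemma IsIrreducibleMap.eq_smul_of_isHermitian [Nonempty ι] (hΦ : IsPositiveMap Φ)
    (hirr : IsIrreducibleMap Φ) {x y : Matrix ι ι ℂ} {s : ℝ} (hs : 0 ≤ s) (hx : x.PosDef)
    (hxs : Φ x = (s : ℂ) • x) (hy : y.IsHermitian) (hys : Φ y = (s : ℂ) • y) :
    ∃ t : ℝ, y = (t : ℂ) • x := by
  set S := {t : ℝ | ((t : ℂ) • x - y).PosSemidef} with hS
  have hne : S.Nonempty := (hx.exists_smul_sub_posSemidef hy).imp fun _ h => h.2
  have hbdd : BddBelow S := by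
    obtain ⟨M, -, hM⟩ := hx.exists_smul_sub_posSemidef hy.neg
    refine ⟨-M, fun t (ht : ((t : ℂ) • x - y).PosSemidef) => ?_⟩
    have h : (((t + M : ℝ) : ℂ) • x).PosSemidef := by
      convert ht.add hM using 1
      push_cast
      module
    have h₁ := (Complex.nonneg_iff.1 h.trace_nonneg).1
    rw [trace_smul, smul_eq_mul, Complex.re_ofReal_mul] at h₁
    have := nonneg_of_mul_nonneg_left h₁ (Complex.pos_iff.1 hx.trace_pos).1
    linarith
  have hclosed : IsClosed S := isClosed_setOf_posSemidef.preimage (by fun_prop)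
  have hm : (((sInf S : ℝ) : ℂ) • x - y).PosSemidef := hclosed.csInf_mem hne hbdd
  refine ⟨sInf S, ?_⟩
  by_contra hxy
  have hpd := hirr.posDef_of_smul_sub hΦ hm (sub_ne_zero.2 (Ne.symm hxy)) hs (by
    convert PosSemidef.zero using 1
    rw [map_sub, map_smul, hxs, hys]
    module)
  obtain ⟨ε, hε, h⟩ := hpd.exists_sub_smul_posSemidef hx.1
  have : sInf S - ε ∈ S := by
    rw [hS, Set.mem_ofPred_eq]
    convert h using 1
    push_cast
    module
  linarith [csInf_le hbdd this]

lemma IsIrreducibleMap.eq_smul_of_map_eq_smul [Nonempty ι] (hΦ : IsPositiveMap Φ)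
    (hirr : IsIrreducibleMap Φ) {x y : Matrix ι ι ℂ} {s : ℝ} (hs : 0 ≤ s) (hx : x.PosDef)
    (hxs : Φ x = (s : ℂ) • x) (hys : Φ y = (s : ℂ) • y) : ∃ c : ℂ, y = c • x := by
  have hys' : Φ yᴴ = (s : ℂ) • yᴴ := by
    rw [hΦ.map_conjTranspose, hys, conjTranspose_smul, RCLike.star_def, Complex.conj_ofReal]
  obtain ⟨a, ha⟩ := hirr.eq_smul_of_isHermitian hΦ hs hx hxs (isHermitian_add_transpose_self y)
    (by rw [map_add, hys, hys', smul_add])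
  obtain ⟨b, hb⟩ := hirr.eq_smul_of_isHermitian hΦ hs hx hxs (y := Complex.I • (y - yᴴ))
    (by simp [IsHermitian, conjTranspose_smul, ← smul_neg])
    (by rw [map_smul, map_sub, hys, hys']; module)
  have hb' := congrArg (Complex.I • ·) hb
  simp only [smul_smul, Complex.I_mul_I, neg_smul, one_smul] at hb'
  refine ⟨(2 : ℂ)⁻¹ * (a - Complex.I * b), ?_⟩
  linear_combination (norm := module) (2 : ℂ)⁻¹ • ha - (2 : ℂ)⁻¹ • hb'

end PositiveMaps

/-- Irreducible quantum Perron–Frobenius theorem: if `Φ` is an irreducible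
positive linear map on `n × n` complex matrices (no nontrivial projection `p`
satisfies `Φ p ≤ a p` for some `a ≥ 0`), then the spectral radius `r` is a
geometrically simple eigenvalue, and its eigenvector can be chosen strictly
positive (positive definite); moreover up to a positive scalar it is the unique
positive semidefinite eigenvector of `Φ`. -/
theorem irreducible_perron_frobenius {n : ℕ} (hn : 0 < n)
    (Φ : Matrix (Fin n) (Fin n) ℂ →ₗ[ℂ] Matrix (Fin n) (Fin n) ℂ)
    (hpos : ∀ x : Matrix (Fin n) (Fin n) ℂ, x.PosSemidef → (Φ x).PosSemidef)
    -- irreducibility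
    (hirr : ¬ ∃ (p : Matrix (Fin n) (Fin n) ℂ) (a : ℝ), 0 ≤ a ∧
      p * p = p ∧ p.IsHermitian ∧ p ≠ 0 ∧ p ≠ 1 ∧
      ((a : ℂ) • p - Φ p).PosSemidef) :
    -- `r` is the spectral radius of `Φ`
    let r : ℝ := sSup ((fun c : ℂ => ‖c‖) ''
      spectrum ℂ (Φ : Module.End ℂ (Matrix (Fin n) (Fin n) ℂ)))
    ∃ x : Matrix (Fin n) (Fin n) ℂ,
      -- `x` is a strictly positive eigenvector for the eigenvalue `r`
      x.PosDef ∧ Φ x = (r : ℂ) • x ∧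
      -- `r` is geometrically simple
      (∀ y : Matrix (Fin n) (Fin n) ℂ, Φ y = (r : ℂ) • y → ∃ c : ℂ, y = c • x) ∧
      -- `x` is, up to a positive scalar, the unique positive semidefinite
      -- eigenvector of `Φ`
      (∀ y : Matrix (Fin n) (Fin n) ℂ, y.PosSemidef → y ≠ 0 →
        ∀ c : ℂ, Φ y = c • y → ∃ t : ℝ, 0 < t ∧ y = (t : ℂ) • x) := by
  intro r
  have : Nonempty (Fin n) := ⟨⟨0, hn⟩⟩
  have hΦ : IsPositiveMap Φ := hpos
  have hirr' : IsIrreducibleMap Φ := by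
    intro p a ha hp hpH h
    by_contra! hne
    exact hirr ⟨p, a, ha, hp, hpH, hne.1, hne.2, h⟩
  obtain ⟨s, hs, x, hx, hxs⟩ := hirr'.exists_posDef_eigenvector hΦ
  have hxtr := Complex.pos_iff.1 hx.trace_pos
  have hx0 : x ≠ 0 := by
    rintro rfl
    simpa using hxtr.1
  have hr : r = s := by
    refine IsGreatest.csSup_eq ⟨⟨s, ?_, by simpa using hs⟩, ?_⟩
    · exact Module.End.hasEigenvalue_iff_mem_spectrum.1
        (Module.End.hasEigenvalue_of_hasEigenvector
          ⟨Module.End.mem_eigenspace_iff.2 hxs, hx0⟩)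
    · rintro _ ⟨c, hc, rfl⟩
      obtain ⟨y, hy, hy0⟩ :=
        (Module.End.hasEigenvalue_iff_mem_spectrum.2 hc).exists_hasEigenvector
      by_contra! hlt
      exact hy0 (hΦ.eq_zero_of_map_eq_smul hx hs hxs (Module.End.mem_eigenspace_iff.1 hy) hlt)
  rw [hr]
  refine ⟨x, hx, hxs, fun y hy => hirr'.eq_smul_of_map_eq_smul hΦ hs hx hxs hy,
    fun y hy hy0 c hyc => ?_⟩
  obtain ⟨hytr, hytr'⟩ := hy.trace_re_pos_s16 hy0
  obtain ⟨c, rfl⟩ : ∃ c' : ℝ, c = c' := by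
    have h := (Complex.nonneg_iff.1 (hΦ y hy).trace_nonneg).2
    rw [hyc, trace_smul, hytr', smul_eq_mul, Complex.im_mul_ofReal] at h
    exact ⟨c.re, Complex.ext rfl (by simpa [hytr.ne'] using h.symm)⟩
  have hc : 0 ≤ c := by
    have h := (Complex.nonneg_iff.1 (hΦ y hy).trace_nonneg).1
    rw [hyc, trace_smul, smul_eq_mul, Complex.re_ofReal_mul] at h
    exact nonneg_of_mul_nonneg_left h hytr
  have hypd : y.PosDef := hirr'.posDef_of_smul_sub hΦ hy hy0 hc (by simp [hyc, PosSemidef.zero])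
  have hcs : c = s := by
    apply le_antisymm
    · by_contra! hlt
      exact hy0 (hΦ.eq_zero_of_map_eq_smul hx hs hxs hyc (by simpa [abs_of_nonneg hc] using hlt))
    · by_contra! hlt
      exact hx0 (hΦ.eq_zero_of_map_eq_smul hypd hc hyc hxs (by simpa [abs_of_nonneg hs] using hlt))
  obtain ⟨t, rfl⟩ := hirr'.eq_smul_of_isHermitian hΦ hs hx hxs hy.1 (hcs ▸ hyc)
  refine ⟨t, ?_, rfl⟩
  rw [trace_smul, smul_eq_mul, Complex.re_ofReal_mul] at hytr
  exact pos_of_mul_pos_left hytr hxtr.1.le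
end
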